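/- arXiv:2311.09893 — 3 statements merged into one kernel-verified Lean document; each statement's English description precedes it below -/
import Mathlib

section
/- Let f : [0,∞) → [0,∞) be measurable with ∫_{ℝ³} f(‖κ‖) dκ = 1 and let L ∈ ℝ^{3×3}. Then ∫_{ℝ³} f(‖κ‖) · P(κ)·L·Lᵀ·P(κ) dκ = (7/15)·L·Lᵀ + (1/15)·‖L‖²·I; in particular, if ‖L‖² = 3 this equals (7/15)·L·Lᵀ + (1/5)·I (the one-point velocity correlation tensor of the turbulence model, up to the factor k). -/
open MeasureTheory

noncomputable section
open scoped Classical

abbrev R3 : Type := EuclideanSpace ℝ (Fin 3)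

/-- The projector `P(κ) = I - (κ/‖κ‖) ⊗ (κ/‖κ‖)`, with `P(0) = I`. -/
def proj (κ : R3) : Matrix (Fin 3) (Fin 3) ℝ :=
  if κ = 0 then 1 else 1 - Matrix.of fun j k => (κ j / ‖κ‖) * (κ k / ‖κ‖)

/-- The squared Frobenius norm of a matrix. -/
def frobSq (M : Matrix (Fin 3) (Fin 3) ℝ) : ℝ := ∑ a, ∑ b, (M a b) ^ 2

noncomputable def mm (f : ℝ → ℝ) (p q r : ℕ) : ℝ := ∫ κ : R3, f ‖κ‖ * ((κ 0 / ‖κ‖)^p * (κ 1 / ‖κ‖)^q * (κ 2 / ‖κ‖)^r)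

def hrefl (v : R3) : R3 ≃ₗᵢ[ℝ] R3 := (ℝ ∙ v)ᗮ.reflection

lemma hrefl_apply (v x : R3) (i : Fin 3) : hrefl v x i =
   x i - 2 * (v 0 * x 0 + v 1 * x 1 + v 2 * x 2) / (v 0^2+v 1^2+v 2^2) * v i := by
  have := Submodule.reflection_singleton_apply (𝕜 := ℝ) v x
  rw [hrefl, Submodule.reflection_orthogonal]
  simp [this, PiLp.inner_apply, Fin.sum_univ_three, EuclideanSpace.norm_sq_eq]
  ring

lemma invm (f : ℝ → ℝ) (g : ℝ → ℝ → ℝ → ℝ) (v : R3) :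
   ∫ κ : R3, f ‖κ‖ * g (κ 0 / ‖κ‖) (κ 1 / ‖κ‖) (κ 2 / ‖κ‖) = 
   ∫ κ : R3, f ‖κ‖ * g (hrefl v κ 0 / ‖κ‖) (hrefl v κ 1 / ‖κ‖) (hrefl v κ 2 / ‖κ‖) := by
  have := (hrefl v).measurePreserving.integral_comp (hrefl v).toHomeomorph.measurableEmbedding (fun κ : R3 => f ‖κ‖ * g (κ 0 / ‖κ‖) (κ 1 / ‖κ‖) (κ 2 / ‖κ‖))
  rw [← this]
  simp

lemma mint (f : ℝ → ℝ) (hi : Integrable (fun κ : R3 => f ‖κ‖)) (p q r : ℕ) :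
    Integrable (fun κ : R3 => f ‖κ‖ * ((κ 0 / ‖κ‖)^p * (κ 1 / ‖κ‖)^q * (κ 2 / ‖κ‖)^r)) := by
  refine Integrable.mul_bdd (c := 1) hi ?_ ?_
  · apply Measurable.aestronglyMeasurable
    fun_prop
  · refine Filter.Eventually.of_forall fun κ => ?_
    have h : ∀ i, ‖κ i / ‖κ‖‖ ≤ 1 := fun i => by
      rw [norm_div, norm_norm]
      exact div_le_one_of_le₀ (PiLp.norm_apply_le κ i) (norm_nonneg _)
    rw [norm_mul, norm_mul, norm_pow, norm_pow, norm_pow]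
    have h' : ∀ i n, ‖κ i / ‖κ‖‖ ^ n ≤ 1 := fun i n => pow_le_one₀ (norm_nonneg _) (h i)
    exact mul_le_one₀ (mul_le_one₀ (h' _ _) (by positivity) (h' _ _)) (by positivity) (h' _ _)

lemma flip0 (f) (p q r) : mm f p q r = (-1)^p * mm f p q r := by
  conv_lhs => rw [mm, invm f (fun x y z => x^p*y^q*z^r) !₂[1,0,0]]
  rw [mm, ← integral_const_mul]
  congr 1; ext κ
  simp only [hrefl_apply]
  simp
  rw [show κ 0 - 2 * κ 0 = -κ 0 by ring, neg_div, neg_pow]; ring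

lemma swap01 (f) (p q r) : mm f p q r = mm f q p r := by
  rw [mm, invm f (fun x y z => x^p*y^q*z^r) !₂[1,-1,0], mm]
  congr 1; ext κ
  simp only [hrefl_apply]
  simp
  rw [show κ 0 - 2 * (κ 0 + -κ 1) / (1+1) = κ 1 by ring, show κ 1 + 2 * (κ 0 + -κ 1) / (1+1) = κ 0 by ring]; ring_nf; simp

lemma swap12 (f) (p q r) : mm f p q r = mm f p r q := by
  rw [mm, invm f (fun x y z => x^p*y^q*z^r) !₂[0,1,-1], mm]
  congr 1; ext κ
  simp only [hrefl_apply]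
  simp
  rw [show κ 1 - 2 * (κ 1 + -κ 2) / (1+1) = κ 2 by ring, show κ 2 + 2 * (κ 1 + -κ 2) / (1+1) = κ 1 by ring]; ring_nf; simp

lemma odd0 (f) (p q r) (h : Odd p) : mm f p q r = 0 := by
  have := flip0 f p q r
  rw [h.neg_one_pow] at this; linarith
lemma odd1 (f) (p q r) (h : Odd q) : mm f p q r = 0 := by
  rw [swap01, odd0 _ _ _ _ h]
lemma odd2 (f) (p q r) (h : Odd r) : mm f p q r = 0 := by
  rw [swap12, odd1 _ _ _ _ h]

lemma rot (f : ℝ → ℝ) (hi : Integrable (fun κ : R3 => f ‖κ‖)) : mm f 4 0 0 = 3 * mm f 2 2 0 := by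
  have h : mm f 2 2 0 = (144/625) * mm f 4 0 0 + (-168/625) * mm f 3 1 0 + (-239/625) * mm f 2 2 0 + (168/625) * mm f 1 3 0 + (144/625) * mm f 0 4 0 := by
    conv_lhs => rw [mm, invm f (fun x y z => x^2*y^2*z^0) !₂[1,2,0]]
    simp only [mm]
    have I := mint f hi
    rw [← integral_const_mul, ← integral_const_mul, ← integral_const_mul, ← integral_const_mul, ← integral_const_mul,
      ← integral_add, ← integral_add, ← integral_add, ← integral_add]
    · congr 1; ext κ
      simp only [hrefl_apply]
      simp
      ring
    all_goals
      first
      | exact (I _ _ _).const_mul _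
      | exact ((I _ _ _).const_mul _).add ((I _ _ _).const_mul _)
      | exact (((I _ _ _).const_mul _).add ((I _ _ _).const_mul _)).add ((I _ _ _).const_mul _)
      | exact ((((I _ _ _).const_mul _).add ((I _ _ _).const_mul _)).add ((I _ _ _).const_mul _)).add ((I _ _ _).const_mul _)
  rw [odd0 f 3 1 0 (by decide), odd0 f 1 3 0 (by decide), swap01 f 0 4 0] at h
  linarith

lemma nsum (κ : R3) (h : κ ≠ 0) : (κ 0 / ‖κ‖)^2 + (κ 1 / ‖κ‖)^2 + (κ 2 / ‖κ‖)^2 = 1 := by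
  have h1 := EuclideanSpace.real_norm_sq_eq κ
  rw [Fin.sum_univ_three] at h1
  have : ‖κ‖ ≠ 0 := norm_ne_zero_iff.2 h
  field_simp
  linarith

lemma recm (f : ℝ → ℝ) (hi : Integrable (fun κ : R3 => f ‖κ‖)) (p q r : ℕ) :
    mm f p q r = mm f (p+2) q r + mm f p (q+2) r + mm f p q (r+2) := by
  have I := mint f hi
  simp only [mm]
  rw [← integral_add (I _ _ _) (I _ _ _), ← integral_add]
  rotate_left
  · exact (I _ _ _).add (I _ _ _)
  · exact I _ _ _
  apply integral_congr_ae
  filter_upwards [Measure.ae_ne volume (0 : R3)] with κ hκ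
  have := nsum κ hκ
  linear_combination (-(f ‖κ‖ * ((κ 0 / ‖κ‖)^p * (κ 1 / ‖κ‖)^q * (κ 2 / ‖κ‖)^r))) * this

lemma vals (f : ℝ → ℝ) (hi : Integrable (fun κ : R3 => f ‖κ‖)) (h1 : ∫ κ : R3, f ‖κ‖ = 1) :
    mm f 2 0 0 = 1/3 ∧ mm f 4 0 0 = 1/5 ∧ mm f 2 2 0 = 1/15 := by
  have h0 : mm f 0 0 0 = 1 := by simpa [mm] using h1
  have a := recm f hi 0 0 0
  have b := recm f hi 2 0 0
  have c := rot f hi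
  have s1 := swap01 f 0 2 0
  have s2 := swap12 f 0 0 2
  have s3 := swap12 f 2 0 2
  simp only [zero_add] at *
  norm_num at *
  refine ⟨?_, ?_, ?_⟩ <;> linarith

def HI (g : R3 → ℝ) (c : ℝ) : Prop := Integrable g ∧ ∫ κ, g κ = c

lemma HI.add {g h : R3 → ℝ} {c d : ℝ} (hg : HI g c) (hh : HI h d) :
    HI (fun κ => g κ + h κ) (c + d) :=
  ⟨hg.1.add hh.1, by rw [integral_add hg.1 hh.1, hg.2, hh.2]⟩

lemma HI.cmul {g : R3 → ℝ} {c : ℝ} (a : ℝ) (hg : HI g c) : HI (fun κ => a * g κ) (a * c) :=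
  ⟨hg.1.const_mul a, by rw [integral_const_mul, hg.2]⟩

lemma HI.sum {g : Fin 3 → R3 → ℝ} {c : Fin 3 → ℝ} (hg : ∀ i, HI (g i) (c i)) :
    HI (fun κ => ∑ i, g i κ) (∑ i, c i) :=
  ⟨integrable_finsetSum _ fun i _ => (hg i).1, by
    rw [integral_finsetSum _ fun i _ => (hg i).1]
    exact Finset.sum_congr rfl fun i _ => (hg i).2⟩

def dl (i j : Fin 3) : ℝ := if i = j then 1 else 0
def dn (i j : Fin 3) : ℕ := if i = j then 1 else 0

lemma n_eq (n : Fin 3 → ℝ) (i : Fin 3) : n i = n 0 ^ dn i 0 * n 1 ^ dn i 1 * n 2 ^ dn i 2 := by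
  fin_cases i <;> simp [dn]

lemma E2 (f : ℝ → ℝ) (hi : Integrable (fun κ : R3 => f ‖κ‖)) (h1 : ∫ κ : R3, f ‖κ‖ = 1)
    (i j : Fin 3) : HI (fun κ => f ‖κ‖ * ((κ i / ‖κ‖) * (κ j / ‖κ‖))) (dl i j / 3) := by
  have e : (fun κ : R3 => f ‖κ‖ * ((κ i / ‖κ‖) * (κ j / ‖κ‖))) = fun κ : R3 => f ‖κ‖ *
      ((κ 0 / ‖κ‖)^(dn i 0 + dn j 0) * (κ 1 / ‖κ‖)^(dn i 1 + dn j 1)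
        * (κ 2 / ‖κ‖)^(dn i 2 + dn j 2)) := by
    ext κ
    rw [n_eq (fun i => κ i / ‖κ‖) i, n_eq (fun i => κ i / ‖κ‖) j]
    ring
  rw [e]
  refine ⟨mint f hi _ _ _, ?_⟩
  change mm f _ _ _ = _
  obtain ⟨v2, -, -⟩ := vals f hi h1
  have v2' : mm f 0 2 0 = 1/3 := by rw [swap01, v2]
  have v2'' : mm f 0 0 2 = 1/3 := by rw [swap12, v2']
  have a := odd0 f 1 1 0 (by decide)
  have b := odd0 f 1 0 1 (by decide)
  have c := odd1 f 0 1 1 (by decide)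
  fin_cases i <;> fin_cases j <;> simp [dn, dl, v2, v2', v2'', a, b, c]

lemma E4 (f : ℝ → ℝ) (hi : Integrable (fun κ : R3 => f ‖κ‖)) (h1 : ∫ κ : R3, f ‖κ‖ = 1)
    (i j k l : Fin 3) :
    HI (fun κ => f ‖κ‖ * ((κ i / ‖κ‖) * (κ j / ‖κ‖) * (κ k / ‖κ‖) * (κ l / ‖κ‖)))
      ((dl i j * dl k l + dl i k * dl j l + dl i l * dl j k) / 15) := by
  have e : (fun κ : R3 => f ‖κ‖ * ((κ i / ‖κ‖) * (κ j / ‖κ‖) * (κ k / ‖κ‖) * (κ l / ‖κ‖)))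
      = fun κ : R3 => f ‖κ‖ *
      ((κ 0 / ‖κ‖)^(dn i 0 + dn j 0 + dn k 0 + dn l 0)
        * (κ 1 / ‖κ‖)^(dn i 1 + dn j 1 + dn k 1 + dn l 1)
        * (κ 2 / ‖κ‖)^(dn i 2 + dn j 2 + dn k 2 + dn l 2)) := by
    ext κ
    rw [n_eq (fun i => κ i / ‖κ‖) i, n_eq (fun i => κ i / ‖κ‖) j,
      n_eq (fun i => κ i / ‖κ‖) k, n_eq (fun i => κ i / ‖κ‖) l]
    ring
  rw [e]
  refine ⟨mint f hi _ _ _, ?_⟩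
  change mm f _ _ _ = _
  obtain ⟨-, v4, v22⟩ := vals f hi h1
  have v4' : mm f 0 4 0 = 1/5 := by rw [swap01, v4]
  have v4'' : mm f 0 0 4 = 1/5 := by rw [swap12, v4']
  have w : mm f 2 0 2 = 1/15 := by rw [swap12, v22]
  have w' : mm f 0 2 2 = 1/15 := by rw [swap01, w]
  have o0 := odd0 f
  have o1 := odd1 f
  have a1 := o0 3 1 0 (by decide)
  have a2 := o0 3 0 1 (by decide)
  have a3 := o0 1 3 0 (by decide)
  have a4 := o0 1 0 3 (by decide)
  have a5 := o1 0 1 3 (by decide)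
  have a6 := o1 0 3 1 (by decide)
  have a7 := o0 1 1 2 (by decide)
  have a8 := o0 1 2 1 (by decide)
  have a9 := o1 2 1 1 (by decide)
  clear o0 o1 e
  fin_cases i <;> fin_cases j <;> fin_cases k <;> fin_cases l <;>
    simp [dn, dl, v4, v4', v4'', v22, w, w', a1, a2, a3, a4, a5, a6, a7, a8, a9] <;> norm_num

lemma proj_eq (κ : R3) (i j : Fin 3) : proj κ i j = dl i j - (κ i / ‖κ‖) * (κ j / ‖κ‖) := by
  unfold proj dl
  split_ifs with h h' h' <;> simp [h, h', Matrix.one_apply]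

lemma frob_eq (L : Matrix (Fin 3) (Fin 3) ℝ) : frobSq L = ∑ k, (L * L.transpose) k k := by
  simp [frobSq, Matrix.mul_apply, Matrix.transpose_apply, pow_two]

lemma mainM (f : ℝ → ℝ) (hi : Integrable (fun κ : R3 => f ‖κ‖)) (h1 : ∫ κ : R3, f ‖κ‖ = 1)
    (M : Matrix (Fin 3) (Fin 3) ℝ) (hM : ∀ i j, M i j = M j i) (a b : Fin 3) :
    (∫ κ : R3, f ‖κ‖ * (proj κ * M * proj κ) a b)
      = (7/15) * M a b + (1/15) * (∑ k, M k k) * dl a b := by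
  have H0 : HI (fun κ => f ‖κ‖) 1 := ⟨hi, h1⟩
  have H := ((H0.cmul (M a b)).add
    (HI.sum fun k => (E2 f hi h1 a k).cmul (-M k b))).add
    ((HI.sum fun k => (E2 f hi h1 k b).cmul (-M a k)).add
    (HI.sum fun k => HI.sum fun l => (E4 f hi h1 a k l b).cmul (M k l)))
  refine Eq.trans ?_ (H.2.trans ?_)
  · congr 1
    ext κ
    simp only [Matrix.mul_apply, proj_eq, Fin.sum_univ_three]
    clear H H0 hi h1 hM
    generalize ‖κ‖ = N
    fin_cases a <;> fin_cases b <;> simp [dl] <;> ring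
  · simp only [Fin.sum_univ_three]
    have m1 := hM 0 1
    have m2 := hM 0 2
    have m3 := hM 1 2
    clear H H0 hi h1 hM
    fin_cases a <;> fin_cases b <;> simp [dl, m1, m2, m3] <;> ring

/-- For measurable `f ≥ 0` with `∫_{ℝ³} f(‖κ‖) dκ = 1` and any `L ∈ ℝ^{3×3}`:
`∫ f(‖κ‖) P(κ)·L·Lᵀ·P(κ) dκ = (7/15)·L·Lᵀ + (1/15)·‖L‖²·I`; in particular, if `‖L‖² = 3`
this equals `(7/15)·L·Lᵀ + (1/5)·I`. -/
theorem stmt5 (f : ℝ → ℝ) (hf_meas : Measurable f) (hf_nonneg : ∀ r, 0 ≤ f r)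
    (hf_int : (∫ κ : R3, f ‖κ‖) = 1) (L : Matrix (Fin 3) (Fin 3) ℝ) :
    (∀ a b : Fin 3,
      (∫ κ : R3, f ‖κ‖ * (proj κ * (L * L.transpose) * proj κ) a b)
        = ((7/15 : ℝ) • (L * L.transpose)
            + ((1/15 : ℝ) * frobSq L) • (1 : Matrix (Fin 3) (Fin 3) ℝ)) a b) ∧
    (frobSq L = 3 → ∀ a b : Fin 3,
      (∫ κ : R3, f ‖κ‖ * (proj κ * (L * L.transpose) * proj κ) a b)
        = ((7/15 : ℝ) • (L * L.transpose)
            + (1/5 : ℝ) • (1 : Matrix (Fin 3) (Fin 3) ℝ)) a b) := by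
  have hi : Integrable (fun κ : R3 => f ‖κ‖) := by
    by_contra h
    rw [integral_undef h] at hf_int
    exact zero_ne_one hf_int
  have hM : ∀ i j, (L * L.transpose) i j = (L * L.transpose) j i := fun i j => by
    simp only [Matrix.mul_apply, Matrix.transpose_apply, mul_comm]
  have key := mainM f hi hf_int (L * L.transpose) hM
  constructor
  · intro a b
    rw [key, frob_eq]
    simp [Matrix.one_apply, dl]
  · intro h a b
    rw [key, ← frob_eq, h]
    simp [Matrix.one_apply, dl]
    norm_num
end
end

section
/- Let ζ > 0, let f_x : [0,∞) → [0,∞) be measurable with ∫_{ℝ³} ‖κ‖² f_x(‖κ‖) dκ = 1/(2ζ), and let L ∈ ℝ^{3×3} with ‖L‖² = 3. Then the dissipation integral identity ∫_{ℝ³} ‖κ‖² · f_x(‖κ‖) · ‖P(κ)·L‖² dκ = 1/ζ holds. -/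
open MeasureTheory

noncomputable section
open scoped Classical

lemma h_col (u0 u1 u2 a b c : ℝ) (h : u0^2+u1^2+u2^2 = 1) :
    (a - u0*(u0*a+u1*b+u2*c))^2 + (b - u1*(u0*a+u1*b+u2*c))^2 + (c - u2*(u0*a+u1*b+u2*c))^2
      = a^2+b^2+c^2 - (u0*a+u1*b+u2*c)^2 := by
  linear_combination (u0*a+u1*b+u2*c)^2 * h

lemma h_point (L : Matrix (Fin 3) (Fin 3) ℝ) (κ : R3) :
    ‖κ‖ ^ 2 * frobSq (proj κ * L)
      = ‖κ‖ ^ 2 * frobSq L - ∑ b, ∑ j, ∑ k, L j b * L k b * (κ j * κ k) := by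
  by_cases h0 : κ = 0
  · subst h0; simp
  have hN : ‖κ‖ ≠ 0 := norm_ne_zero_iff.mpr h0
  have hsq : ‖κ‖ ^ 2 = κ 0 ^ 2 + κ 1 ^ 2 + κ 2 ^ 2 := by
    rw [EuclideanSpace.norm_sq_eq]; simp [Fin.sum_univ_three]
  obtain ⟨u, hu⟩ : ∃ u : Fin 3 → ℝ, ∀ i, u i = κ i / ‖κ‖ := ⟨_, fun _ => rfl⟩
  have hk : ∀ i, κ i = ‖κ‖ * u i := fun i => by rw [hu]; field_simp
  have h1 : u 0 ^ 2 + u 1 ^ 2 + u 2 ^ 2 = 1 := by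
    rw [hu, hu, hu]; field_simp; exact hsq.symm
  have hent : ∀ a b, (proj κ * L) a b = L a b - u a * (u 0 * L 0 b + u 1 * L 1 b + u 2 * L 2 b) := by
    intro a b
    rw [proj, if_neg h0, Matrix.sub_mul, Matrix.one_mul, Matrix.sub_apply]
    simp only [Matrix.mul_apply, Matrix.of_apply,
      Fin.sum_univ_three, ← hu]
    ring
  have hf : frobSq (proj κ * L)
      = frobSq L - ∑ b, (u 0 * L 0 b + u 1 * L 1 b + u 2 * L 2 b)^2 := by
    unfold frobSq
    rw [Finset.sum_comm, Finset.sum_comm (f := fun a b => L a b ^ 2), ← Finset.sum_sub_distrib]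
    refine Finset.sum_congr rfl fun b _ => ?_
    simp only [hent, Fin.sum_univ_three]
    exact h_col _ _ _ _ _ _ h1
  rw [hf, mul_sub, Finset.mul_sum]
  congr 1
  refine Finset.sum_congr rfl fun b _ => ?_
  simp only [Fin.sum_univ_three]
  rw [hk 0, hk 1, hk 2]
  ring

lemma h_inv (e : R3 ≃ₗᵢ[ℝ] R3) (g : R3 → ℝ) : ∫ κ, g (e κ) = ∫ κ, g κ :=
  e.measurePreserving.integral_comp e.toHomeomorph.measurableEmbedding g

lemma h_diag (f : ℝ → ℝ) (j k : Fin 3) :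
    ∫ κ : R3, f ‖κ‖ * (κ j * κ j) = ∫ κ : R3, f ‖κ‖ * (κ k * κ k) := by
  let e : R3 ≃ₗᵢ[ℝ] R3 := LinearIsometryEquiv.piLpCongrLeft 2 ℝ ℝ (Equiv.swap j k)
  rw [← h_inv e]
  have : ∀ κ : R3, (e κ) j = κ k := fun κ => by
    simp [e, LinearIsometryEquiv.piLpCongrLeft_apply, Equiv.piCongrLeft']
  simp only [this, LinearIsometryEquiv.norm_map]

lemma h_off (f : ℝ → ℝ) (j k : Fin 3) (h : j ≠ k) :
    ∫ κ : R3, f ‖κ‖ * (κ j * κ k) = 0 := by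
  let e : R3 ≃ₗᵢ[ℝ] R3 := LinearIsometryEquiv.piLpCongrRight 2
    (fun i => if i = j then LinearIsometryEquiv.neg ℝ else LinearIsometryEquiv.refl ℝ ℝ)
  have hj : ∀ κ : R3, (e κ) j = - κ j := fun κ => by simp [e]
  have hk : ∀ κ : R3, (e κ) k = κ k := fun κ => by simp [e, h.symm]
  have := h_inv e (fun κ => f ‖κ‖ * (κ j * κ k))
  simp only [hj, hk, LinearIsometryEquiv.norm_map, neg_mul, mul_neg, integral_neg] at this
  linarith

/-- Dissipation integral identity: if `∫ ‖κ‖² f(‖κ‖) dκ = 1/(2ζ)` and `‖L‖² = 3`, then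
`∫ ‖κ‖² f(‖κ‖) ‖P(κ)·L‖² dκ = 1/ζ`. -/
theorem stmt7 (ζ : ℝ) (hζ : 0 < ζ) (f : ℝ → ℝ)
    (hf_meas : Measurable f) (hf_nonneg : ∀ r, 0 ≤ f r)
    (hf_int : (∫ κ : R3, ‖κ‖ ^ 2 * f ‖κ‖) = 1 / (2 * ζ))
    (L : Matrix (Fin 3) (Fin 3) ℝ) (hL : frobSq L = 3) :
    (∫ κ : R3, ‖κ‖ ^ 2 * f ‖κ‖ * frobSq (proj κ * L)) = 1 / ζ := by
  have hA : (1 : ℝ) / (2 * ζ) ≠ 0 := by positivity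
  have hI : Integrable (fun κ : R3 => ‖κ‖ ^ 2 * f ‖κ‖) := by
    by_contra hc
    exact hA (hf_int ▸ integral_undef hc)
  have hIjk : ∀ j k : Fin 3, Integrable (fun κ : R3 => f ‖κ‖ * (κ j * κ k)) := by
    intro j k
    refine hI.mono' ?_ (Filter.Eventually.of_forall fun κ => ?_)
    · have : Measurable (fun κ : R3 => f ‖κ‖ * (κ j * κ k)) :=
        (hf_meas.comp measurable_norm).mul (by fun_prop)
      exact this.aestronglyMeasurable
    · rw [norm_mul, norm_mul, Real.norm_of_nonneg (hf_nonneg _), mul_comm, sq]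
      exact mul_le_mul_of_nonneg_right (mul_le_mul (PiLp.norm_apply_le κ j) (PiLp.norm_apply_le κ k)
        (norm_nonneg _) (norm_nonneg _)) (hf_nonneg _)
  have hsum : (∫ κ : R3, ‖κ‖ ^ 2 * f ‖κ‖) = ∑ j : Fin 3, ∫ κ : R3, f ‖κ‖ * (κ j * κ j) := by
    rw [← integral_finsetSum _ (fun j _ => hIjk j j)]
    congr 1
    ext κ
    rw [EuclideanSpace.norm_sq_eq]
    simp only [Fin.sum_univ_three, Real.norm_eq_abs, sq_abs]
    ring
  have hd : ∀ j : Fin 3, ∫ κ : R3, f ‖κ‖ * (κ j * κ j) = 1 / (2 * ζ) / 3 := by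
    intro j
    rw [← hf_int, hsum, Finset.sum_congr rfl (fun k _ => h_diag f k j)]
    simp
  have hG : ∀ j k : Fin 3, ∫ κ : R3, f ‖κ‖ * (κ j * κ k) = if j = k then 1 / (2 * ζ) / 3 else 0 := by
    intro j k
    split_ifs with h
    · subst h; exact hd j
    · exact h_off f j k h
  have hpt : ∀ κ : R3, ‖κ‖ ^ 2 * f ‖κ‖ * frobSq (proj κ * L) = 3 * (‖κ‖ ^ 2 * f ‖κ‖)
      - ∑ b, ∑ j, ∑ k, L j b * L k b * (f ‖κ‖ * (κ j * κ k)) := by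
    intro κ
    have h := h_point L κ
    rw [hL] at h
    have : ∑ b, ∑ j, ∑ k, L j b * L k b * (f ‖κ‖ * (κ j * κ k))
        = f ‖κ‖ * ∑ b, ∑ j, ∑ k, L j b * L k b * (κ j * κ k) := by
      simp only [Finset.mul_sum]
      refine Finset.sum_congr rfl fun b _ => Finset.sum_congr rfl fun j _ =>
        Finset.sum_congr rfl fun k _ => by ring
    rw [this]
    linear_combination f ‖κ‖ * h
  have i3 : ∀ b j k : Fin 3, Integrable (fun κ : R3 => L j b * L k b * (f ‖κ‖ * (κ j * κ k))) :=
    fun b j k => (hIjk j k).const_mul _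
  have i2 : ∀ b j : Fin 3, Integrable (fun κ : R3 => ∑ k, L j b * L k b * (f ‖κ‖ * (κ j * κ k))) :=
    fun b j => integrable_finsetSum _ fun k _ => i3 b j k
  have i1 : ∀ b : Fin 3, Integrable
      (fun κ : R3 => ∑ j, ∑ k, L j b * L k b * (f ‖κ‖ * (κ j * κ k))) :=
    fun b => integrable_finsetSum _ fun j _ => i2 b j
  simp_rw [hpt]
  rw [integral_sub (hI.const_mul 3) (integrable_finsetSum _ fun b _ => i1 b),
    integral_const_mul, hf_int, integral_finsetSum _ (fun b _ => i1 b)]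
  simp_rw [integral_finsetSum _ (fun j _ => i2 _ j), integral_finsetSum _ (fun k _ => i3 _ _ k),
    integral_const_mul, hG]
  have hL2 : ∑ b, ∑ j, L j b * L j b = 3 := by
    rw [← hL, frobSq, Finset.sum_comm]
    simp only [sq]
  simp only [mul_ite, mul_zero, Finset.sum_ite_eq, Finset.mem_univ, if_true, ← Finset.sum_mul, hL2]
  field_simp
  norm_num
end
end

section
/- For every ζ ∈ (0, ζ_crit), the equation (C_K⁻¹ + B(ζ)·y)²·(1 − y²) − A(ζ)²·y² = 0 has exactly one solution y₀(ζ) in the open interval (0,1). -/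
noncomputable section

def CK : ℝ := 3/2
def a4 : ℝ := 230/9
def a5 : ℝ := -391/9
def a6 : ℝ := 170/9
def b7 : ℝ := 209/9
def b8 : ℝ := -352/9
def b9 : ℝ := 152/9

def ahat1 : ℝ := 3/2 + (a4/5 + a5/6 + a6/7)
def ahat2 : ℝ := 3/4 - (a4/7 + a5/8 + a6/9)
def bhat1 : ℝ := 3/2 - (b7/6 + b8/7 + b9/8)
def bhat2 : ℝ := 3/4 + (b7/4 + b8/5 + b9/6)

def zetaCrit : ℝ := (2 * CK ^ 3 * (bhat2 - ahat2) * (bhat1 - ahat1) ^ 2)⁻¹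

def Afun (ζ : ℝ) : ℝ := ahat1 * Real.sqrt (2 * CK * ahat2 * ζ)
def Bfun (ζ : ℝ) : ℝ := bhat1 * Real.sqrt (2 * CK * bhat2 * ζ)

theorem stmt16_unique_aux (c A B x y : ℝ) (hc : 0 < c) (hB : 0 < B)
    (hx0 : 0 < x) (hy1 : y < 1) (hxy : x < y)
    (hx : (c + B * x) ^ 2 * (1 - x ^ 2) - A ^ 2 * x ^ 2 = 0)
    (hy : (c + B * y) ^ 2 * (1 - y ^ 2) - A ^ 2 * y ^ 2 = 0) : False := by
  have hy0 : 0 < y := hx0.trans hxy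
  have h1 : (c + B * y) * x < (c + B * x) * y := by nlinarith
  have h0 : 0 < (c + B * y) * x := by positivity
  have h2 : ((c + B * y) * x) ^ 2 < ((c + B * x) * y) ^ 2 := by
    apply pow_lt_pow_left₀ h1 h0.le (by norm_num)
  have h3 : 1 - y ^ 2 < 1 - x ^ 2 := by nlinarith
  have h4 : 0 < 1 - y ^ 2 := by nlinarith
  have h5 : ((c + B * y) * x) ^ 2 * (1 - y ^ 2) < ((c + B * x) * y) ^ 2 * (1 - x ^ 2) :=
    mul_lt_mul h2 h3.le h4 (by positivity)
  have h6 : ((c + B * y) * x) ^ 2 * (1 - y ^ 2) = ((c + B * x) * y) ^ 2 * (1 - x ^ 2) := by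
    linear_combination x ^ 2 * hy - y ^ 2 * hx
  exact absurd h6 h5.ne

/-- For every `ζ ∈ (0, ζ_crit)`, the equation
`(C_K⁻¹ + B(ζ)·y)²·(1 − y²) − A(ζ)²·y² = 0` has exactly one solution in `(0,1)`. -/
theorem stmt16 (ζ : ℝ) (hζ0 : 0 < ζ) (hζ : ζ < zetaCrit) :
    ∃! y : ℝ, y ∈ Set.Ioo (0:ℝ) 1 ∧
      (CK⁻¹ + Bfun ζ * y) ^ 2 * (1 - y ^ 2) - (Afun ζ) ^ 2 * y ^ 2 = 0 := by
  have hc : 0 < CK⁻¹ := by norm_num [CK]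
  have hA : 0 < Afun ζ := by
    unfold Afun
    refine mul_pos (by norm_num [ahat1, a4, a5, a6]) (Real.sqrt_pos.2 (mul_pos ?_ hζ0))
    norm_num [CK, ahat2, a4, a5, a6]
  have hB : 0 < Bfun ζ := by
    unfold Bfun
    refine mul_pos (by norm_num [bhat1, b7, b8, b9]) (Real.sqrt_pos.2 (mul_pos ?_ hζ0))
    norm_num [CK, bhat2, b7, b8, b9]
  generalize CK⁻¹ = c at *
  generalize Afun ζ = A at *
  generalize Bfun ζ = B at *
  have hcont : ContinuousOn
      (fun y : ℝ => (c + B * y) ^ 2 * (1 - y ^ 2) - A ^ 2 * y ^ 2) (Set.Icc 0 1) := by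
    fun_prop
  have hmem : (0 : ℝ) ∈ Set.Ioo
      ((fun y : ℝ => (c + B * y) ^ 2 * (1 - y ^ 2) - A ^ 2 * y ^ 2) 1)
      ((fun y : ℝ => (c + B * y) ^ 2 * (1 - y ^ 2) - A ^ 2 * y ^ 2) 0) := by
    have := pow_pos hA 2
    have := pow_pos hc 2
    constructor <;> norm_num <;> positivity
  obtain ⟨y, hy, hy0⟩ := intermediate_value_Ioo' zero_le_one hcont hmem
  refine ⟨y, ⟨hy, hy0⟩, ?_⟩
  rintro z ⟨hz, hz0⟩
  rcases lt_trichotomy z y with h | h | h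
  · exact (stmt16_unique_aux c A B z y hc hB hz.1 hy.2 h hz0 hy0).elim
  · exact h
  · exact (stmt16_unique_aux c A B y z hc hB hy.1 hz.2 h hy0 hz0).elim
end
end
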